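/- Let V be a finite-dimensional complex vector space and let G be a finite subgroup of GL(V) generated by its reflections, where a reflection is an element g ≠ 1 whose fixed subspace V^g is a hyperplane. Let Γ be a subgroup of G of index 2 containing no reflection of G. Then every reflection of G has order 2, and Γ = G ∩ SL(V). -/

import Mathlib

noncomputable section

/-- The subspace of fixed points of a linear automorphism. -/
def fixedSubspace {V : Type*} [AddCommGroup V] [Module ℂ V] (g : V ≃ₗ[ℂ] V) :
    Submodule ℂ V :=
  LinearMap.ker ((g : V →ₗ[ℂ] V) - LinearMap.id)

/-- A reflection: a nontrivial linear automorphism whose fixed subspace is a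
hyperplane. -/
def IsReflection {V : Type*} [AddCommGroup V] [Module ℂ V] (g : V ≃ₗ[ℂ] V) : Prop :=
  g ≠ 1 ∧ Module.finrank ℂ (fixedSubspace g) = Module.finrank ℂ V - 1

theorem fixedSubspace_le_pow {V : Type*} [AddCommGroup V] [Module ℂ V] (g : V ≃ₗ[ℂ] V) (n : ℕ) :
    fixedSubspace g ≤ fixedSubspace (g ^ n) := by
  intro x hx
  have hx' : g x = x := by simpa [fixedSubspace, sub_eq_zero] using hx
  have h : (g ^ n) x = x := by
    induction n with
    | zero => simp
    | succ n ih => rw [pow_succ, LinearEquiv.mul_apply, hx', ih]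
  simpa [fixedSubspace, sub_eq_zero] using h

theorem fixedSubspace_ne_top {V : Type*} [AddCommGroup V] [Module ℂ V] {g : V ≃ₗ[ℂ] V}
    (hg : g ≠ 1) : fixedSubspace g ≠ ⊤ := by
  intro h
  refine hg (LinearEquiv.ext fun x => ?_)
  have hx : x ∈ fixedSubspace g := h ▸ Submodule.mem_top
  simpa [fixedSubspace, sub_eq_zero] using hx

/-- A nontrivial power of a reflection is a reflection. -/
theorem IsReflection.pow {V : Type*} [AddCommGroup V] [Module ℂ V] [FiniteDimensional ℂ V]
    {g : V ≃ₗ[ℂ] V} (hg : IsReflection g) {n : ℕ} (hn : g ^ n ≠ 1) : IsReflection (g ^ n) := by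
  refine ⟨hn, ?_⟩
  have h₁ := Submodule.finrank_mono (fixedSubspace_le_pow g n)
  have h₂ := Submodule.finrank_lt (fixedSubspace_ne_top hn)
  have h₃ := hg.2
  omega

theorem IsReflection.mem_dilatransvections {V : Type*} [AddCommGroup V] [Module ℂ V]
    [FiniteDimensional ℂ V] {g : V ≃ₗ[ℂ] V} (hg : IsReflection g) :
    g ∈ LinearEquiv.dilatransvections ℂ V := by
  rw [LinearEquiv.mem_dilatransvections_iff_finrank]
  have h := LinearMap.finrank_range_add_finrank_ker ((g : V →ₗ[ℂ] V) - LinearMap.id)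
  have h' : Module.finrank ℂ (LinearMap.ker ((g : V →ₗ[ℂ] V) - LinearMap.id)) =
    Module.finrank ℂ V - 1 := hg.2
  omega

/-- A reflection of order two has determinant `-1`. -/
theorem IsReflection.det_eq_neg_one {V : Type*} [AddCommGroup V] [Module ℂ V]
    [FiniteDimensional ℂ V] {g : V ≃ₗ[ℂ] V} (hg : IsReflection g) (hsq : g ^ 2 = 1) :
    LinearMap.det (g : V →ₗ[ℂ] V) = -1 := by
  obtain ⟨f, v, hfv⟩ := hg.mem_dilatransvections
  have hgx (x : V) : g x = x + f x • v := LinearMap.congr_fun hfv x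
  obtain ⟨x, hx⟩ : ∃ x, f x • v ≠ 0 := by
    by_contra! h
    exact hg.1 (LinearEquiv.ext fun x => by simp [hgx, h])
  have hgg : g (g x) = x := by
    rw [← LinearEquiv.mul_apply, ← sq, hsq, LinearEquiv.coe_one, id]
  have hzero : (2 + f v) • f x • v = 0 := by
    rw [hgx, hgx, map_add, map_smul, smul_eq_mul, add_assoc, add_eq_left] at hgg
    rw [← hgg]
    module
  have hv : 2 + f v = 0 := (smul_eq_zero.mp hzero).resolve_right hx
  rw [hfv, LinearMap.transvection.det]
  linear_combination hv

theorem stmt_15 (V : Type*) [AddCommGroup V] [Module ℂ V] [FiniteDimensional ℂ V]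
    (G : Subgroup (V ≃ₗ[ℂ] V)) (hGfin : Finite G)
    (hgen : G = Subgroup.closure {g : V ≃ₗ[ℂ] V | g ∈ G ∧ IsReflection g})
    (Γ : Subgroup (V ≃ₗ[ℂ] V)) (hΓG : Γ ≤ G)
    (hindex : (Γ.subgroupOf G).index = 2)
    (hnorefl : ∀ g ∈ Γ, ¬ IsReflection g) :
    (∀ g ∈ G, IsReflection g → orderOf g = 2) ∧
    (∀ g : V ≃ₗ[ℂ] V, g ∈ Γ ↔ g ∈ G ∧ LinearMap.det (g : V →ₗ[ℂ] V) = 1) := by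
  have hmul {a b : V ≃ₗ[ℂ] V} (ha : a ∈ G) (hb : b ∈ G) : a * b ∈ Γ ↔ (a ∈ Γ ↔ b ∈ Γ) :=
    Subgroup.mul_mem_iff_of_index_two hindex (a := ⟨a, ha⟩) (b := ⟨b, hb⟩)
  have hsq {g : V ≃ₗ[ℂ] V} (hg : g ∈ G) (hr : IsReflection g) : g ^ 2 = 1 := by
    by_contra h
    exact hnorefl _ (sq g ▸ (hmul hg hg).2 Iff.rfl) (hr.pow h)
  refine ⟨fun g hg hr => orderOf_eq_prime (hsq hg hr) hr.1, ?_⟩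
  have hdet : ∀ g ∈ G, (g ∈ Γ ∧ LinearMap.det (g : V →ₗ[ℂ] V) = 1) ∨
      (g ∉ Γ ∧ LinearMap.det (g : V →ₗ[ℂ] V) = -1) := by
    intro g hg
    rw [hgen] at hg
    induction hg using Subgroup.closure_induction with
    | mem g hg => exact .inr ⟨fun h => hnorefl g h hg.2, hg.2.det_eq_neg_one (hsq hg.1 hg.2)⟩
    | one => exact .inl ⟨one_mem Γ, LinearMap.det_id⟩
    | mul a b ha hb iha ihb =>
      rw [← hgen] at ha hb
      have hab : LinearMap.det ((a * b : V ≃ₗ[ℂ] V) : V →ₗ[ℂ] V) =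
          LinearMap.det (a : V →ₗ[ℂ] V) * LinearMap.det (b : V →ₗ[ℂ] V) :=
        LinearMap.det_comp _ _
      rw [hmul ha hb, hab]
      rcases iha with ⟨h₁, h₂⟩ | ⟨h₁, h₂⟩ <;> rcases ihb with ⟨h₃, h₄⟩ | ⟨h₃, h₄⟩ <;>
        simp [h₁, h₂, h₃, h₄]
    | inv a ha iha =>
      have hinv : LinearMap.det ((a⁻¹ : V ≃ₗ[ℂ] V) : V →ₗ[ℂ] V) *
          LinearMap.det (a : V →ₗ[ℂ] V) = 1 := LinearEquiv.det_symm_mul_det a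
      rw [inv_mem_iff]
      refine iha.imp (fun h => ⟨h.1, ?_⟩) (fun h => ⟨h.1, ?_⟩)
      · simpa [h.2] using hinv
      · rw [h.2] at hinv
        linear_combination -hinv
  intro g
  refine ⟨fun hg => ⟨hΓG hg, ?_⟩, fun ⟨hg, h⟩ => ?_⟩
  · exact ((hdet g (hΓG hg)).resolve_right fun h => h.1 hg).2
  · rcases hdet g hg with h' | h'
    · exact h'.1
    · have := h.symm.trans h'.2
      norm_num at this
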